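/- Let k ≥ 2, t > 0, and 2 ≤ i ≤ k. Then for every function f : (ℝ^n)^{k+1} → ℝ one has, pointwise on (ℝ^n)^{k+1}: b(η_{k,i,t} f) + η_{k−1,i,t}(b f) = (−1)^{i−1} Ψ_{k,i−1,t}·f + Ψ_{k,i−1,t}·Σ_{j=0}^{i−2} (−1)^j s_{k−1,i−2}(b_j f) + (−1)^i Ψ_{k,i,t}·f + Ψ_{k,i,t}·Σ_{j=0}^{i−1} (−1)^j s_{k−1,i−1}(b_j f). -/

import Mathlib

open scoped BigOperators
open MeasureTheory

noncomputable section

abbrev Euc (n : ℕ) : Type := EuclideanSpace ℝ (Fin n)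

/-- The `i`-th simplicial face map `D_i : E^k → E^{k+1}`. -/
def face {n : ℕ} (k i : ℕ) (x : Fin k → Euc n) : Fin (k + 1) → Euc n :=
  fun l =>
    if _hle : (l : ℕ) ≤ i then
      if h : (l : ℕ) < k then x ⟨l, h⟩
      else if h0 : 0 < k then x ⟨0, h0⟩ else 0
    else x ⟨(l : ℕ) - 1, by have hl := l.isLt; omega⟩

/-- The Hochschild boundary `b f = ∑ (-1)^i f ∘ D_i`. -/
def hb {n k : ℕ} (f : (Fin (k + 1) → Euc n) → ℝ) : (Fin k → Euc n) → ℝ :=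
  fun x => ∑ i ∈ Finset.range (k + 1), (-1 : ℝ) ^ i * f (face k i x)

/-- Degeneracy `σ_i` omitting the `(i+1)`-st entry. -/
def degen {n : ℕ} (i : ℕ) {m : ℕ} (x : Fin (m + 1) → Euc n) : Fin m → Euc n :=
  fun l =>
    if (l : ℕ) ≤ i then x ⟨l, by have hl := l.isLt; omega⟩
    else x ⟨(l : ℕ) + 1, by have hl := l.isLt; omega⟩

/-- Squared distance of cyclically consecutive entries. -/
def dsq {n m : ℕ} (x : Fin m → Euc n) (j : ℕ) : ℝ :=
  if hm : 0 < m then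
    ‖x ⟨j % m, Nat.mod_lt _ hm⟩ - x ⟨(j + 1) % m, Nat.mod_lt _ hm⟩‖ ^ 2
  else 0

/-- Cutoff `Ψ` with `i` factors on `E^m`. -/
def Psi {n : ℕ} (ρ : ℝ → ℝ) (i : ℕ) (t : ℝ) {m : ℕ} (x : Fin m → Euc n) : ℝ :=
  ∏ j ∈ Finset.range i, ρ (dsq x j / t)

/-- `η_{m,i,t} g = Ψ_{m+1,i,t} · (g ∘ σ_{i-1})`. -/
def eta {n : ℕ} (ρ : ℝ → ℝ) (i : ℕ) (t : ℝ) {m : ℕ} (g : (Fin m → Euc n) → ℝ) :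
    (Fin (m + 1) → Euc n) → ℝ :=
  fun x => Psi ρ i t x * g (degen (i - 1) x)

/-- `H_{m,t} = ∑_{i=1}^{m+1} (-1)^{i+1} η_{m,i,t}`. -/
def Hmap {n : ℕ} (ρ : ℝ → ℝ) (t : ℝ) {m : ℕ} (g : (Fin m → Euc n) → ℝ) :
    (Fin (m + 1) → Euc n) → ℝ :=
  fun x => ∑ i ∈ Finset.Icc 1 m, (-1 : ℝ) ^ (i + 1) * eta ρ i t g x

/-- `K_{m,t} g = ∫_t^1 H_{m,s/2}(∂_s Ψ_{m,s} · g) ds`. -/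
def Kmap {n : ℕ} (ρ : ℝ → ℝ) (t : ℝ) {m : ℕ} (g : (Fin m → Euc n) → ℝ) :
    (Fin (m + 1) → Euc n) → ℝ :=
  fun x => ∫ s in t..(1 : ℝ), Hmap ρ (s / 2) (fun y => deriv (fun u => Psi ρ m u y) s * g y) x

/-- Standard basis vector in the `j`-th block, `l`-th coordinate. -/
def blockVec (n m j : ℕ) (l : Fin n) : Fin m → Euc n :=
  fun j' => if (j' : ℕ) = j then EuclideanSpace.single l 1 else 0

/-- Iterated partial derivative `∂^α_j`. -/
def mpderiv {n m : ℕ} (j : ℕ) (α : Fin n → ℕ) (g : (Fin m → Euc n) → ℝ) :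
    (Fin m → Euc n) → ℝ :=
  (List.finRange n).foldr
    (fun l gg => (fun h (x : Fin m → Euc n) => fderiv ℝ h x (blockVec n m j l))^[α l] gg) g

theorem degen_face_of_le {n k i j : ℕ} (hj : j ≤ i) (hjk : j < k) (x : Fin (k + 1) → Euc n) :
    degen (i + 1) (face (k + 1) j x) = face k j (degen i x) := by
  funext l
  have hl := l.isLt
  simp only [degen, face]
  split_ifs <;> first | omega | (congr 2; omega) | rfl

theorem degen_face_self {n k i : ℕ} (x : Fin (k + 1) → Euc n) :
    degen i (face (k + 1) i x) = x := by
  funext l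
  have hl := l.isLt
  simp only [degen, face]
  split_ifs <;> first | omega | rfl

theorem degen_face_succ {n k i : ℕ} (x : Fin (k + 1) → Euc n) :
    degen i (face (k + 1) (i + 1) x) = x := by
  funext l
  have hl := l.isLt
  simp only [degen, face]
  split_ifs <;> first | omega | rfl

theorem degen_face_of_gt {n k i j : ℕ} (hj : i + 1 ≤ j) (hk : j ≤ k)
    (x : Fin (k + 1) → Euc n) :
    degen i (face (k + 1) (j + 1) x) = face k j (degen i x) := by
  funext l
  have hl := l.isLt
  simp only [degen, face]
  split_ifs <;> first | omega | (congr 2; omega) | rfl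

theorem dsq_of_lt {n m j : ℕ} (hj : j + 1 < m) (x : Fin m → Euc n) :
    dsq x j = ‖x ⟨j, by omega⟩ - x ⟨j + 1, hj⟩‖ ^ 2 := by
  have hm : 0 < m := by omega
  simp only [dsq, hm, dif_pos, Nat.mod_eq_of_lt hj, Nat.mod_eq_of_lt (show j < m by omega)]

theorem dsq_face_of_lt {n k j l : ℕ} (hl : l < j) (hk : l + 1 ≤ k)
    (x : Fin (k + 1) → Euc n) : dsq (face (k + 1) j x) l = dsq x l := by
  rw [dsq_of_lt (by omega), dsq_of_lt (by omega)]
  simp only [face]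
  split_ifs <;> first | omega | rfl

theorem dsq_face_self {n k j : ℕ} (hk : j ≤ k)
    (x : Fin (k + 1) → Euc n) : dsq (face (k + 1) j x) j = 0 := by
  rw [dsq_of_lt (by omega)]
  simp only [face]
  split_ifs <;> first | omega | simp

theorem dsq_face_succ_of_le {n k j l : ℕ} (hl : j ≤ l) (hk : l + 1 ≤ k)
    (x : Fin (k + 1) → Euc n) : dsq (face (k + 1) j x) (l + 1) = dsq x l := by
  rw [dsq_of_lt (by omega), dsq_of_lt (by omega)]
  simp only [face]
  split_ifs <;> first | omega | rfl

theorem Psi_face_of_le {n k i j : ℕ} (ρ : ℝ → ℝ) (t : ℝ) (hij : i ≤ j) (hik : i ≤ k)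
    (x : Fin (k + 1) → Euc n) : Psi ρ i t (face (k + 1) j x) = Psi ρ i t x := by
  refine Finset.prod_congr rfl fun l hl => ?_
  rw [Finset.mem_range] at hl
  rw [dsq_face_of_lt (by omega) (by omega)]

theorem Psi_succ_face_of_le {n k i j : ℕ} (ρ : ℝ → ℝ) (hρ : ρ 0 = 1) (t : ℝ) (hji : j ≤ i)
    (hik : i ≤ k) (x : Fin (k + 1) → Euc n) :
    Psi ρ (i + 1) t (face (k + 1) j x) = Psi ρ i t x := by
  obtain ⟨r, rfl⟩ := Nat.exists_eq_add_of_le hji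
  simp only [Psi]
  rw [add_assoc, Finset.prod_range_add _ j (r + 1), Finset.prod_range_add _ j r,
    Finset.prod_range_succ', add_zero, dsq_face_self (by omega), zero_div, hρ, mul_one]
  congr 1
  · refine Finset.prod_congr rfl fun l hl => ?_
    rw [Finset.mem_range] at hl
    rw [dsq_face_of_lt hl (by omega)]
  · refine Finset.prod_congr rfl fun l hl => ?_
    rw [Finset.mem_range] at hl
    rw [← add_assoc, dsq_face_succ_of_le (by omega) (by omega)]

theorem alternating_sum_add_of_shift {R : Type*} [CommRing R] {i k : ℕ} (hik : i + 1 ≤ k)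
    (a c : ℕ → R) (h : ∀ j, i + 1 ≤ j → j ≤ k → a (j + 1) = c j) :
    ∑ j ∈ Finset.range (k + 2), (-1) ^ j * a j + ∑ j ∈ Finset.range (k + 1), (-1) ^ j * c j
      = (-1) ^ i * a i + ∑ j ∈ Finset.range i, (-1) ^ j * a j + (-1) ^ (i + 1) * a (i + 1)
        + ∑ j ∈ Finset.range (i + 1), (-1) ^ j * c j := by
  obtain ⟨q, rfl⟩ := Nat.exists_eq_add_of_le hik
  rw [show i + 1 + q + 2 = i + 1 + 1 + (q + 1) by omega, add_assoc (i + 1) q 1,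
    Finset.sum_range_add _ (i + 1 + 1), Finset.sum_range_add _ (i + 1) (q + 1),
    Finset.sum_range_succ _ (i + 1), Finset.sum_range_succ _ i]
  have hcancel : ∑ j ∈ Finset.range (q + 1), (-1) ^ (i + 1 + 1 + j) * a (i + 1 + 1 + j)
      = -∑ j ∈ Finset.range (q + 1), (-1) ^ (i + 1 + j) * c (i + 1 + j) := by
    rw [← Finset.sum_neg_distrib]
    refine Finset.sum_congr rfl fun j hj => ?_
    rw [Finset.mem_range] at hj
    rw [← h (i + 1 + j) (by omega) (by omega), add_right_comm (i + 1) 1 j, pow_succ]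
    ring
  rw [hcancel]
  ring

theorem stmt12 {n : ℕ} (hn : 1 ≤ n)
    (ρ : ℝ → ℝ) (hρsmooth : ContDiff ℝ (⊤ : ℕ∞) ρ)
    (hρ0 : ∀ r : ℝ, 0 ≤ ρ r) (hρ1 : ∀ r : ℝ, ρ r ≤ 1)
    (hρone : ∀ r : ℝ, r ≤ 1 / 3 → ρ r = 1) (hρzero : ∀ r : ℝ, 1 / 2 < r → ρ r = 0)
    {k : ℕ} (hk : 2 ≤ k) (t : ℝ) (ht : 0 < t)
    (i : ℕ) (hi2 : 2 ≤ i) (hik : i ≤ k)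
    (f : (Fin (k + 1) → Euc n) → ℝ) (x : Fin (k + 1) → Euc n) :
    hb (eta ρ i t f) x + eta ρ i t (hb f) x
      = (-1 : ℝ) ^ (i - 1) * (Psi ρ (i - 1) t x * f x)
        + Psi ρ (i - 1) t x *
            ∑ j ∈ Finset.range (i - 1), (-1 : ℝ) ^ j * f (face k j (degen (i - 2) x))
        + (-1 : ℝ) ^ i * (Psi ρ i t x * f x)
        + Psi ρ i t x *
            ∑ j ∈ Finset.range i, (-1 : ℝ) ^ j * f (face k j (degen (i - 1) x)) := by
  have hρ : ρ 0 = 1 := hρone 0 (by norm_num)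
  obtain ⟨p, rfl⟩ := Nat.exists_eq_add_of_le' hi2
  simp only [hb, eta, show p + 2 - 1 = p + 1 by omega, show p + 2 - 2 = p by omega,
    Finset.mul_sum, mul_left_comm (Psi ρ _ t x)]
  rw [alternating_sum_add_of_shift (i := p + 1) (by omega),
    Psi_succ_face_of_le ρ hρ t le_rfl (by omega), degen_face_self,
    Psi_face_of_le ρ t le_rfl hik, degen_face_succ]
  · congr 3
    refine Finset.sum_congr rfl fun j hj => ?_
    rw [Finset.mem_range] at hj
    rw [Psi_succ_face_of_le ρ hρ t (by omega) (by omega),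
      degen_face_of_le (by omega) (by omega)]
  · intro j hj hjk
    rw [Psi_face_of_le ρ t (by omega) hik, degen_face_of_gt hj hjk]
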